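/- (Third dissociation theorem, 'Galjordanhölder') Let L/K be a galtourable extension of finite degree. (1) Every strict Galois tower of L/K admits a refinement which is a Galois composition tower of L/K, i.e. a strict Galois tower all of whose steps are galsimple. (2) Any two Galois composition towers of L/K are equivalent: they have the same number m of steps, and there is a permutation σ of {1,…,m} such that Gal(F_i/F_{i-1}) is isomorphic to Gal(E_{σ(i)}/E_{σ(i)-1}) for all i. -/

import Mathlib

/-- A Galois tower of the extension `L/K`: a finite increasing chain of intermediate
fields from `K` (i.e. `⊥`) to `L` (i.e. `⊤`) each of whose steps is a Galois extension. -/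
def IsGaloisTower {K L : Type*} [Field K] [Field L] [Algebra K L] {m : ℕ}
    (F : Fin (m + 1) → IntermediateField K L) : Prop :=
  Monotone F ∧ F 0 = ⊥ ∧ F (Fin.last m) = ⊤ ∧
    ∀ i : Fin m, ∀ h : F i.castSucc ≤ F i.succ,
      IsGalois (F i.castSucc) (IntermediateField.extendScalars h)

/-- An extension `L/K` is galtourable if it admits a Galois tower. -/
def Galtourable (K L : Type*) [Field K] [Field L] [Algebra K L] : Prop :=
  ∃ (m : ℕ) (F : Fin (m + 1) → IntermediateField K L), IsGaloisTower F


/-- An extension `L/K` is galsimple if it is nontrivial and admits no proper nontrivial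
Galois quotient extension: `L ≠ K`, and every intermediate field `F` with `F/K` Galois
satisfies `F = K` or `F = L`. -/
def Galsimple (K L : Type*) [Field K] [Field L] [Algebra K L] : Prop :=
  (⊥ : IntermediateField K L) ≠ ⊤ ∧
    ∀ F : IntermediateField K L, IsGalois K F → F = ⊥ ∨ F = ⊤

/-- A tower `E` (with `n` steps) refines a tower `F` (with `m` steps) of the same
extension if the fields of `F` appear, in order, among the fields of `E`. -/
def Refines {K L : Type*} [Field K] [Field L] [Algebra K L] {m n : ℕ}
    (E : Fin (n + 1) → IntermediateField K L)
    (F : Fin (m + 1) → IntermediateField K L) : Prop :=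
  ∃ j : Fin (m + 1) → Fin (n + 1), StrictMono j ∧ ∀ i, F i = E (j i)

/-- Two Galois towers are equivalent if they have the same number of steps and, up to a
permutation of the steps, the Galois groups of corresponding steps are isomorphic as
topological groups (for their Krull topologies). -/
def TowerEquiv {K L : Type*} [Field K] [Field L] [Algebra K L] {m n : ℕ}
    (F : Fin (m + 1) → IntermediateField K L)
    (E : Fin (n + 1) → IntermediateField K L) : Prop :=
  ∃ σ : Fin m ≃ Fin n, ∀ i : Fin m,
    ∀ (hF : F i.castSucc ≤ F i.succ) (hE : E (σ i).castSucc ≤ E (σ i).succ),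
      ∃ e : (↥(IntermediateField.extendScalars hF) ≃ₐ[↥(F i.castSucc)]
              ↥(IntermediateField.extendScalars hF)) ≃*
            (↥(IntermediateField.extendScalars hE) ≃ₐ[↥(E (σ i).castSucc)]
              ↥(IntermediateField.extendScalars hE)),
        Continuous e ∧ Continuous e.symm

/-- A Galois composition tower of `L/K`: a strict Galois tower all of whose steps are
galsimple extensions. -/
def IsGaloisCompositionTower {K L : Type*} [Field K] [Field L] [Algebra K L] {m : ℕ}
    (F : Fin (m + 1) → IntermediateField K L) : Prop :=
  StrictMono F ∧ IsGaloisTower F ∧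
    ∀ i : Fin m, ∀ h : F i.castSucc ≤ F i.succ,
      Galsimple (F i.castSucc) (IntermediateField.extendScalars h)

open IntermediateField

/-- A finite Galois extension is galsimple if and only if its Galois group is simple. -/
theorem galsimple_iff_isSimpleGroup (K L : Type*) [Field K] [Field L] [Algebra K L]
    [FiniteDimensional K L] [IsGalois K L] : Galsimple K L ↔ IsSimpleGroup Gal(L/K) := by
  have key : ∀ F : IntermediateField K L, F.fixingSubgroup.Normal ↔ IsGalois K F :=
    fun F => InfiniteGalois.normal_iff_isGalois F
  constructor
  · rintro ⟨hne, h⟩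
    refine { exists_pair_ne := ?_, eq_bot_or_eq_top_of_normal := fun H hH => ?_ }
    · by_contra! hs
      have : Subsingleton Gal(L/K) := ⟨hs⟩
      apply hne
      rw [← IsGalois.fixedField_fixingSubgroup (⊥ : IntermediateField K L),
        ← IsGalois.fixedField_fixingSubgroup (⊤ : IntermediateField K L)]
      congr 1
      exact Subsingleton.elim _ _
    · rw [← fixingSubgroup_fixedField H] at hH ⊢
      rcases h _ ((key _).1 hH) with h | h <;> rw [h]
      · exact Or.inr fixingSubgroup_bot
      · exact Or.inl fixingSubgroup_top
  · intro hs
    refine ⟨fun h => ?_, fun F hF => ?_⟩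
    · apply bot_ne_top (α := Subgroup Gal(L/K))
      rw [← fixingSubgroup_bot, ← fixingSubgroup_top, h]
    · rw [← IsGalois.fixedField_fixingSubgroup F]
      rcases hs.eq_bot_or_eq_top_of_normal _ ((key F).2 hF) with h | h <;> rw [h]
      · exact Or.inr fixedField_bot
      · refine Or.inl ?_
        rw [← fixingSubgroup_bot, IsGalois.fixedField_fixingSubgroup]

/-- The isomorphism of automorphism groups induced by an isomorphism of field extensions. -/
def AlgEquiv.autCongrOfRingEquiv {k l k' l' : Type*} [Field k] [Field l] [Field k'] [Field l']
    [Algebra k l] [Algebra k' l'] (f : k ≃+* k') (g : l ≃+* l')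
    (h : ∀ x, g (algebraMap k l x) = algebraMap k' l' (f x)) : Gal(l/k) ≃* Gal(l'/k') where
  toFun σ := AlgEquiv.ofRingEquiv (f := (g.symm.trans σ.toRingEquiv).trans g) fun x => by
    obtain ⟨x, rfl⟩ := f.surjective x
    simp [← h]
  invFun σ := AlgEquiv.ofRingEquiv (f := (g.trans σ.toRingEquiv).trans g.symm) fun x => by
    simp [h, RingEquiv.symm_apply_eq]
  left_inv σ := by ext; simp
  right_inv σ := by ext; simp
  map_mul' σ τ := by ext; simp

section Step

variable {K L : Type*} [Field K] [Field L] [Algebra K L] {a b c x y z : IntermediateField K L}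

theorem isGalois_extendScalars_of_le (hab : a ≤ b) (hac : a ≤ c) (hcb : c ≤ b)
    [IsGalois a (extendScalars hab)] : IsGalois c (extendScalars hcb) := by
  let := (inclusion hac).toRingHom.toAlgebra
  let : Algebra c (extendScalars hab) := (inclusion hcb).toRingHom.toAlgebra
  have : IsScalarTower a c (extendScalars hab) := IsScalarTower.of_algebraMap_eq fun _ => rfl
  have := IsGalois.tower_top_of_isGalois a c (extendScalars hab)
  exact IsGalois.of_equiv_equiv (f := RingEquiv.refl c)
    (g := (RingEquiv.refl _ : extendScalars hab ≃+* extendScalars hcb)) rfl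

theorem isGalois_extendScalars_inf (hx : z ≤ x) (hy : z ≤ y) [IsGalois z (extendScalars hx)]
    [IsGalois z (extendScalars hy)] : IsGalois z (extendScalars (le_inf hx hy)) := by
  rw [← extendScalars_inf hx hy]
  exact { to_isSeparable := Algebra.IsSeparable.of_algHom z (extendScalars hx)
            (inclusion inf_le_left)
          to_normal := normal_inf _ _ _ _ }

theorem isGalois_restrict_iff (hab : a ≤ b) (hac : a ≤ c) (hcb : c ≤ b) :
    IsGalois a (restrict (show extendScalars hac ≤ extendScalars hab from hcb)) ↔
      IsGalois a (extendScalars hac) :=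
  (restrictAlgEquiv (show extendScalars hac ≤ extendScalars hab from hcb)).symm.transfer_galois

theorem isGalois_and_gal_mulEquiv_of_sup_eq_top {k M : Type*} [Field k] [Field M] [Algebra k M]
    [FiniteDimensional k M] (A B : IntermediateField k M) [IsGalois k A] (hsup : A ⊔ B = ⊤)
    (hinf : A ⊓ B = ⊥) : IsGalois B M ∧ Nonempty (Gal(M/B) ≃* Gal(A/k)) := by
  have := IsGalois.sup_right A B hsup
  exact ⟨this, ⟨MulEquiv.ofBijective (restrictRestrictAlgEquivMapHom k A B M)
    ⟨restrictRestrictAlgEquivMapHom_injective A B hsup,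
      restrictRestrictAlgEquivMapHom_surjective A B hinf⟩⟩⟩

theorem isGalois_and_gal_mulEquiv_sup [FiniteDimensional K L] (x y : IntermediateField K L)
    [IsGalois ↥(x ⊓ y) (extendScalars (inf_le_left : x ⊓ y ≤ x))] :
    IsGalois y (extendScalars (le_sup_right : y ≤ x ⊔ y)) ∧
      Nonempty (Gal(extendScalars (le_sup_right : y ≤ x ⊔ y)/y) ≃*
        Gal(extendScalars (inf_le_left : x ⊓ y ≤ x)/↥(x ⊓ y))) := by
  let X := extendScalars (inf_le_left : x ⊓ y ≤ x)
  let Y := extendScalars (inf_le_right : x ⊓ y ≤ y)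
  let S := extendScalars (inf_le_left.trans le_sup_left : x ⊓ y ≤ x ⊔ y)
  have hX : X ≤ S := (le_sup_left : x ≤ x ⊔ y)
  have hY : Y ≤ S := (le_sup_right : y ≤ x ⊔ y)
  have hS : X ⊔ Y = S := extendScalars_sup _ _
  have : IsGalois ↥(x ⊓ y) (restrict hX) := (isGalois_restrict_iff _ _ le_sup_left).2 ‹_›
  obtain ⟨hG, ⟨e⟩⟩ := isGalois_and_gal_mulEquiv_of_sup_eq_top (restrict hX) (restrict hY)
    (by rw [← lift_inj, lift_sup, lift_restrict, lift_restrict, lift_top, hS])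
    (by rw [← lift_inj, lift_inf, lift_restrict, lift_restrict, lift_bot, extendScalars_inf,
          extendScalars_self])
  let f : restrict hY ≃+* y := (restrictAlgEquiv hY).symm.toRingEquiv
  let g : S ≃+* extendScalars (le_sup_right : y ≤ x ⊔ y) := RingEquiv.refl _
  have hfg : ∀ u, g (algebraMap (restrict hY) S u) = algebraMap y _ (f u) := fun u => by
    obtain ⟨u, rfl⟩ := (restrictAlgEquiv hY).surjective u
    have hu : f (restrictAlgEquiv hY u) = ⟨u, u.2⟩ := (restrictAlgEquiv hY).symm_apply_apply u
    rw [hu]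
    rfl
  exact ⟨IsGalois.of_equiv_equiv (f := f) (g := g) (RingHom.ext fun u => (hfg u).symm),
    ⟨((AlgEquiv.autCongrOfRingEquiv f g hfg).symm.trans e).trans
      (AlgEquiv.autCongr (restrictAlgEquiv hX).symm)⟩⟩

theorem galsimple_extendScalars_iff (hab : a ≤ b) :
    Galsimple a (extendScalars hab) ↔ a ≠ b ∧
      ∀ c, ∀ hac : a ≤ c, c ≤ b → IsGalois a (extendScalars hac) → c = a ∨ c = b := by
  have hbot : ∀ c, ∀ hac : a ≤ c, extendScalars hac = ⊥ ↔ c = a := fun c hac => by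
    rw [← extendScalars_self, ← restrictScalars_inj K]
    rfl
  have htop : ∀ c, ∀ hac : a ≤ c, extendScalars hac = extendScalars hab ↔ c = b :=
    fun c hac => (restrictScalars_inj K).symm
  refine and_congr ?_ ⟨fun h c hac hcb hc => ?_, fun h F hF => ?_⟩
  · rw [ne_eq, ne_eq, ← lift_inj, lift_bot, lift_top, eq_comm, hbot, eq_comm]
  · have := h (restrict (show extendScalars hac ≤ extendScalars hab from hcb))
      ((isGalois_restrict_iff hab hac hcb).2 hc)
    rwa [← lift_inj, ← lift_inj _ ⊤, lift_restrict, lift_bot, lift_top, hbot, htop] at this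
  · have hac : a ≤ (lift F).restrictScalars K := fun u hu => (lift F).algebraMap_mem ⟨u, hu⟩
    have hlift : lift F = extendScalars hac := rfl
    rw [← lift_inj, ← lift_inj _ ⊤, lift_bot, lift_top, hlift, hbot, htop]
    refine h _ hac (lift_le F) ?_
    rw [← hlift]
    exact (liftAlgEquiv F).transfer_galois.1 hF

/-- The extension `b/a` of intermediate fields is Galois. -/
def IsGaloisStep (a b : IntermediateField K L) : Prop :=
  ∃ h : a ≤ b, IsGalois a (extendScalars h)

/-- The extension `b/a` of intermediate fields is Galois and galsimple. -/
def IsGalsimpleStep (a b : IntermediateField K L) : Prop :=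
  ∃ h : a ≤ b, IsGalois a (extendScalars h) ∧ Galsimple a (extendScalars h)

theorem IsGalsimpleStep.lt (h : IsGalsimpleStep a b) : a < b :=
  lt_of_le_of_ne h.1 ((galsimple_extendScalars_iff h.1).1 h.2.2).1

theorem IsGalsimpleStep.inf_eq (hx : IsGalsimpleStep z x) (hy : IsGalsimpleStep z y)
    (hxy : x ≠ y) : x ⊓ y = z := by
  obtain ⟨hzx, hGx, hSx⟩ := id hx
  obtain ⟨hzy, hGy, hSy⟩ := id hy
  have hG := isGalois_extendScalars_inf hzx hzy
  rw [galsimple_extendScalars_iff] at hSx hSy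
  refine (hSx.2 _ _ inf_le_left hG).resolve_right fun h => ?_
  rcases hSy.2 _ (le_inf hzx hzy) inf_le_right hG with h' | h'
  · exact hSx.1 (h'.symm.trans h)
  · exact hxy (h.symm.trans h')

theorem IsGalsimpleStep.sup [FiniteDimensional K L] (hx : IsGalsimpleStep (x ⊓ y) x) :
    IsGalsimpleStep y (x ⊔ y) := by
  obtain ⟨_, _, hS⟩ := hx
  obtain ⟨hG, ⟨e⟩⟩ := isGalois_and_gal_mulEquiv_sup x y
  rw [galsimple_iff_isSimpleGroup] at hS
  refine ⟨le_sup_right, hG, ?_⟩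
  rw [galsimple_iff_isSimpleGroup]
  exact e.isSimpleGroup

/-- The steps `p.2 ≤ p.1` and `q.2 ≤ q.1` have isomorphic automorphism groups. -/
def StepIso (p q : (IntermediateField K L)ᵒᵈ × (IntermediateField K L)ᵒᵈ) : Prop :=
  (p.1 ≤ p.2 ↔ q.1 ≤ q.2) ∧
    ∀ (hp : p.2.ofDual ≤ p.1.ofDual) (hq : q.2.ofDual ≤ q.1.ofDual),
      Nonempty (Gal(extendScalars hp/p.2.ofDual) ≃* Gal(extendScalars hq/q.2.ofDual))

/-- The lattice of intermediate fields of a finite extension, ordered by reverse inclusion, with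
the Galois galsimple steps as its maximal inclusions. -/
abbrev jordanHolderLatticeOrderDual [FiniteDimensional K L] :
    JordanHolderLattice (IntermediateField K L)ᵒᵈ where
  IsMaximal p q := IsGalsimpleStep q.ofDual p.ofDual
  lt_of_isMaximal h := h.lt
  sup_eq_of_isMaximal hx hy hxy := hx.inf_eq hy hxy
  isMaximal_inf_left_of_isMaximal_sup {x y} hx hy := by
    change IsGalsimpleStep (x.ofDual ⊓ y.ofDual) y.ofDual at hy
    change IsGalsimpleStep x.ofDual (x.ofDual ⊔ y.ofDual)
    rw [inf_comm] at hy
    rw [sup_comm]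
    exact hy.sup

attribute [local instance] jordanHolderLatticeOrderDual

theorem stepIso_of_iso [FiniteDimensional K L]
    {p q : (IntermediateField K L)ᵒᵈ × (IntermediateField K L)ᵒᵈ}
    (h : JordanHolderLattice.Iso p q) : StepIso p q := by
  refine JordanHolderLattice.Iso.rel StepIso ?_ ?_ ?_ ?_ h
  · exact fun {x} => ⟨Iff.rfl, fun _ _ => ⟨MulEquiv.refl _⟩⟩
  · exact fun h => ⟨h.1.symm, fun hp hq => (h.2 hq hp).map MulEquiv.symm⟩
  · exact fun h h' => ⟨h.1.trans h'.1, fun hp hq =>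
      (h.2 hp (h.1.1 hp)).elim fun e => (h'.2 (h.1.1 hp) hq).map e.trans⟩
  · intro x y hx
    have hG : IsGalois ↥(x.ofDual ⊓ y.ofDual)
      (extendScalars (inf_le_left : x.ofDual ⊓ y.ofDual ≤ x.ofDual)) := hx.2.1
    exact ⟨iff_of_true le_sup_left inf_le_right, fun _ _ =>
      (isGalois_and_gal_mulEquiv_sup x.ofDual y.ofDual).2.map MulEquiv.symm⟩

theorem IsGaloisCompositionTower.isGalsimpleStep {m : ℕ}
    {C : Fin (m + 1) → IntermediateField K L} (hC : IsGaloisCompositionTower C) (i : Fin m) :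
    IsGalsimpleStep (C i.castSucc) (C i.succ) :=
  have h := hC.2.1.1 i.castSucc_le_succ
  ⟨h, hC.2.1.2.2.2 i h, hC.2.2 i h⟩

/-- A Galois composition tower, seen as a composition series for the reverse inclusion. -/
def IsGaloisCompositionTower.compositionSeries [FiniteDimensional K L] {m : ℕ}
    {C : Fin (m + 1) → IntermediateField K L} (hC : IsGaloisCompositionTower C) :
    CompositionSeries (IntermediateField K L)ᵒᵈ where
  length := m
  toFun i := OrderDual.toDual (C i.rev)
  step i := by
    change IsGalsimpleStep (C i.succ.rev) (C i.castSucc.rev)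
    rw [Fin.rev_succ, Fin.rev_castSucc]
    exact hC.isGalsimpleStep i.rev

theorem IsGaloisCompositionTower.towerEquiv [FiniteDimensional K L] {m n : ℕ}
    {C : Fin (m + 1) → IntermediateField K L} {D : Fin (n + 1) → IntermediateField K L}
    (hC : IsGaloisCompositionTower C) (hD : IsGaloisCompositionTower D) : TowerEquiv C D := by
  obtain ⟨f, hf⟩ := CompositionSeries.jordan_holder hC.compositionSeries hD.compositionSeries
    (congrArg OrderDual.toDual (show C (Fin.rev 0) = D (Fin.rev 0) by
      simp [hC.2.1.2.2.1, hD.2.1.2.2.1]))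
    (congrArg OrderDual.toDual (show C (Fin.rev (Fin.last m)) = D (Fin.rev (Fin.last n)) by
      simp [hC.2.1.2.1, hD.2.1.2.1]))
  let f' : Fin m ≃ Fin n := f
  refine ⟨(Fin.revPerm.trans f').trans Fin.revPerm, fun i hi hj => ?_⟩
  have key : ∀ (i : Fin m) (j : Fin n),
      StepIso (OrderDual.toDual (C i.castSucc.rev), OrderDual.toDual (C i.succ.rev))
        (OrderDual.toDual (D j.castSucc.rev), OrderDual.toDual (D j.succ.rev)) →
      ∀ (hi : C i.rev.castSucc ≤ C i.rev.succ) (hj : D j.rev.castSucc ≤ D j.rev.succ),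
        Nonempty (Gal(extendScalars hi/C i.rev.castSucc) ≃*
          Gal(extendScalars hj/D j.rev.castSucc)) := by
    intro i j h
    rw [Fin.rev_succ, Fin.rev_castSucc, Fin.rev_succ, Fin.rev_castSucc] at h
    exact h.2
  have := key i.rev (f' i.rev) (stepIso_of_iso (hf i.rev))
  rw [Fin.rev_rev] at this
  obtain ⟨e⟩ := this hi hj
  exact ⟨e, continuous_of_discreteTopology, continuous_of_discreteTopology⟩

theorem strictMono_length_le_finrank [FiniteDimensional K L] {n : ℕ}
    {C : Fin (n + 1) → IntermediateField K L} (hC : StrictMono C) : n ≤ Module.finrank K L := by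
  have h : ∀ i : Fin (n + 1), (i : ℕ) ≤ Module.finrank K (C i) := fun i => by
    induction i using Fin.induction with
    | zero => exact Nat.zero_le _
    | succ i ih =>
      exact Nat.succ_le_of_lt (ih.trans_lt
        (Submodule.finrank_lt_finrank_of_lt
        (show (C i.castSucc).toSubmodule < (C i.succ).toSubmodule from hC i.castSucc_lt_succ)))
  exact (h (Fin.last n)).trans (Submodule.finrank_le (C (Fin.last n)).toSubmodule)

/-- The relation of being a strict Galois step. -/
abbrev strictGaloisStep (K L : Type*) [Field K] [Field L] [Algebra K L] :
    SetRel (IntermediateField K L) (IntermediateField K L) :=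
  {p | p.1 < p.2 ∧ IsGaloisStep p.1 p.2}

theorem RelSeries.strictMono_of_strictGaloisStep (s : RelSeries (strictGaloisStep K L)) :
    StrictMono s :=
  Fin.strictMono_iff_lt_succ.2 fun i => (s.step i).1

theorem exists_insertNth_of_not_galsimple (s : RelSeries (strictGaloisStep K L))
    {i : Fin s.length} {h : s i.castSucc ≤ s i.succ}
    (hi : ¬ Galsimple (s i.castSucc) (extendScalars h)) :
    ∃ t : RelSeries (strictGaloisStep K L),
      t.length = s.length + 1 ∧ Set.range s ⊆ Set.range t := by
  obtain ⟨hlt, _, hG⟩ := s.step i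
  rw [galsimple_extendScalars_iff] at hi
  push Not at hi
  obtain ⟨c, hac, hcb, hc, hne, hne'⟩ := hi hlt.ne
  refine ⟨s.insertNth i c ⟨lt_of_le_of_ne hac hne.symm, hac, hc⟩
    ⟨lt_of_le_of_ne hcb hne', hcb, isGalois_extendScalars_of_le h hac hcb⟩, rfl, ?_⟩
  rintro _ ⟨j, rfl⟩
  exact ⟨i.succ.castSucc.succAbove j, Fin.insertNth_apply_succAbove (α := fun _ => IntermediateField K L) _ c s j⟩

theorem exists_compositionTower_refines [FiniteDimensional K L] {m : ℕ}
    {T : Fin (m + 1) → IntermediateField K L} (hT : StrictMono T) (hG : IsGaloisTower T) :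
    ∃ (p : ℕ) (C : Fin (p + 1) → IntermediateField K L),
      Refines C T ∧ IsGaloisCompositionTower C := by
  let S : Set ℕ := {n | ∃ s : RelSeries (strictGaloisStep K L),
    s.length = n ∧ Set.range T ⊆ Set.range s}
  have hS : BddAbove S := ⟨Module.finrank K L, by
    rintro _ ⟨s, rfl, -⟩
    exact strictMono_length_le_finrank s.strictMono_of_strictGaloisStep⟩
  have hne : S.Nonempty := ⟨m, ⟨m, T, fun i => ⟨hT i.castSucc_lt_succ,
    hG.1 i.castSucc_le_succ, hG.2.2.2 i _⟩⟩, rfl, subset_rfl⟩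
  obtain ⟨s, hs, hTs⟩ := Nat.sSup_mem hne hS
  have hmono := s.strictMono_of_strictGaloisStep
  choose j hj using fun i => hTs ⟨i, rfl⟩
  refine ⟨s.length, s, ⟨j, fun i i' h => ?_, fun i => (hj i).symm⟩, hmono,
    ⟨hmono.monotone, ?_, ?_, fun i _ => (s.step i).2.2⟩, fun i h => ?_⟩
  · rw [← hmono.lt_iff_lt, hj, hj]
    exact hT h
  · rw [eq_bot_iff, ← hG.2.1, ← hj]
    exact hmono.monotone (Fin.zero_le _)
  · rw [eq_top_iff, ← hG.2.2.1, ← hj]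
    exact hmono.monotone (Fin.le_last _)
  · by_contra hi
    obtain ⟨t, ht, hst⟩ := exists_insertNth_of_not_galsimple s hi
    have := le_csSup hS ⟨t, rfl, hTs.trans hst⟩
    lia

end Step

/-- Third dissociation theorem ("Galjordanhölder"): let `L/K` be a finite galtourable
extension.  (1) Every strict Galois tower of `L/K` admits a refinement which is a Galois
composition tower of `L/K`.  (2) Any two Galois composition towers of `L/K` are
equivalent. -/
theorem galjordanholder (K L : Type*) [Field K] [Field L] [Algebra K L]
    [FiniteDimensional K L] (hgal : Galtourable K L) :
    (∀ (m : ℕ) (T : Fin (m + 1) → IntermediateField K L),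
        StrictMono T → IsGaloisTower T →
        ∃ (p : ℕ) (C : Fin (p + 1) → IntermediateField K L),
          Refines C T ∧ IsGaloisCompositionTower C) ∧
    (∀ (m n : ℕ) (C₁ : Fin (m + 1) → IntermediateField K L)
        (C₂ : Fin (n + 1) → IntermediateField K L),
        IsGaloisCompositionTower C₁ → IsGaloisCompositionTower C₂ →
        TowerEquiv C₁ C₂) := by
  exact ⟨fun _ _ hT hG => exists_compositionTower_refines hT hG,
    fun _ _ _ _ h₁ h₂ => h₁.towerEquiv h₂⟩
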